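/- Uniform Fernique-type exponential moment bound for α-regular p-exponential measures (Lemma A.1): Let p ∈ [1,2] and fix α₁ > 0. For α > 0 let Π_α = Π(·|α, τ=1) be the α-regular p-exponential measure on ℝ^ℕ. Let r ≥ 1 and let μ be a weighted ℓ_r norm, i.e. μ(θ) = (Σ_ℓ w_ℓ|θ_ℓ|^r)^{1/r} for some nonnegative weights (w_ℓ), and assume μ(θ) < ∞ for Π_α-almost every θ, for all α ≥ α₁. Then there exist constants s₁, s₂ > 0 (depending only on α₁ and μ) such that ∫ e^{s₂μ(θ)} dΠ_α(θ) ≤ s₁ for all α ≥ α₁. -/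

import Mathlib

noncomputable section

open MeasureTheory ProbabilityTheory Filter Set

/-- The index `ℓ = i + 1 ≥ 1` associated to the coordinate `i : ℕ`. -/
def idx (i : ℕ) : ℝ := (i : ℝ) + 1

/-- The `p`-exponential probability density on `ℝ`:
`f_p(x) = exp(−|x|^p/p) / (2 Γ(1/p) p^{1/p−1})`. -/
def pexpDensity (p x : ℝ) : ℝ :=
  Real.exp (-|x| ^ p / p) / (2 * Real.Gamma (1 / p) * p ^ (1 / p - 1))

/-- The `p`-exponential probability measure on `ℝ`. -/
def pexpMeasure (p : ℝ) : Measure ℝ :=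
  MeasureTheory.volume.withDensity fun x => ENNReal.ofReal (pexpDensity p x)

/-- The law of the `i`-th coordinate `τ ℓ^{−1/2−α} ξ` (with `ℓ = i+1`) of a draw from the
`α`-regular `τ`-scaled `p`-exponential prior. -/
def coordLaw (p α τ : ℝ) (i : ℕ) : Measure ℝ :=
  (pexpMeasure p).map fun x => τ * idx i ^ (-(1 / 2 : ℝ) - α) * x

/-- `μ` is the `α`-regular `τ`-scaled `p`-exponential prior on `ℝ^ℕ`: the joint law of the
independent coordinates `τ ℓ^{−1/2−α} ξ_ℓ` with `ξ_ℓ` i.i.d. `p`-exponential. -/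
def IsPexpPrior (p α τ : ℝ) (μ : Measure (ℕ → ℝ)) : Prop :=
  IsProbabilityMeasure μ ∧
  IsProjectiveLimit μ fun I : Finset ℕ => Measure.pi fun i : I => coordLaw p α τ i

/-- `μ` is the Gaussian sequence model measure `P^n_θ`: the joint law of independent
coordinates `X_ℓ ~ N(θ_ℓ, 1/n)`. -/
def IsGaussModel (n : ℕ) (θ : ℕ → ℝ) (μ : Measure (ℕ → ℝ)) : Prop :=
  IsProbabilityMeasure μ ∧
  IsProjectiveLimit μ fun I : Finset ℕ =>
    Measure.pi fun i : I => gaussianReal (θ i) ((n : NNReal))⁻¹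

/-- The `ℓ₂` norm of a sequence (with the `tsum` junk-value convention). -/
def l2norm (θ : ℕ → ℝ) : ℝ := Real.sqrt (∑' i, θ i ^ 2)

/-- Membership in the Sobolev ball `H^β(L)`. -/
def inSobolevBall (β L : ℝ) (θ : ℕ → ℝ) : Prop :=
  Summable (fun i => idx i ^ (2 * β) * θ i ^ 2) ∧
    Real.sqrt (∑' i, idx i ^ (2 * β) * θ i ^ 2) ≤ L

/-- The log-likelihood `ℓ_n(θ) = n Σ_ℓ X_ℓ θ_ℓ − (n/2) ‖θ‖₂²` in the Gaussian sequence model. -/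
def loglik (n : ℕ) (θ X : ℕ → ℝ) : ℝ :=
  (n : ℝ) * (∑' i, X i * θ i) - (n : ℝ) / 2 * ∑' i, θ i ^ 2

/-- The likelihood ratio `p^n_θ(X) = dP^n_θ/dP^n_0 (X)`. -/
def lik (n : ℕ) (θ X : ℕ → ℝ) : ℝ := Real.exp (loglik n θ X)

/-- The marginal likelihood of the data `X` for the prior `prior`. -/
def marginalLik (n : ℕ) (prior : Measure (ℕ → ℝ)) (X : ℕ → ℝ) : ℝ :=
  ∫ θ, lik n θ X ∂prior

/-- The posterior mass of a set `B` given data `X`, for the prior `prior`. -/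
def post (n : ℕ) (prior : Measure (ℕ → ℝ)) (X : ℕ → ℝ) (B : Set (ℕ → ℝ)) : ℝ :=
  (∫ θ in B, lik n θ X ∂prior) / marginalLik n prior X

theorem pexpDensity_nonneg {p : ℝ} (hp : 0 < p) (x : ℝ) : 0 ≤ pexpDensity p x := by
  have := Real.Gamma_pos_of_pos (one_div_pos.2 hp)
  unfold pexpDensity
  positivity

theorem pexpDensity_pos {p : ℝ} (hp : 0 < p) (x : ℝ) : 0 < pexpDensity p x := by
  have := Real.Gamma_pos_of_pos (one_div_pos.2 hp)
  unfold pexpDensity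
  positivity

theorem measurable_pexpDensity (p : ℝ) : Measurable (pexpDensity p) := by
  unfold pexpDensity
  fun_prop

theorem pexpDensity_le_exp_neg_abs {p : ℝ} (hp : p ∈ Icc (1 : ℝ) 2) (x : ℝ) :
    pexpDensity p x ≤
      Real.exp 1 / (2 * Real.Gamma (1 / p) * p ^ (1 / p - 1)) * Real.exp (-(1 / 2) * |x|) := by
  obtain ⟨hp1, hp2⟩ := hp
  have hp0 : 0 < p := by linarith
  have := Real.Gamma_pos_of_pos (one_div_pos.2 hp0)
  have hx : |x| - 1 ≤ |x| ^ p := by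
    rcases le_total 1 |x| with h | h
    · have := Real.rpow_le_rpow_of_exponent_le h hp1
      rw [Real.rpow_one] at this
      linarith
    · have : 0 ≤ |x| ^ p := by positivity
      linarith
  have hexp : -|x| ^ p / p ≤ 1 + -(1 / 2) * |x| := by
    rw [div_le_iff₀ hp0]
    nlinarith [abs_nonneg x]
  unfold pexpDensity
  rw [div_mul_eq_mul_div, ← Real.exp_add]
  gcongr

theorem integrable_rpow_abs_mul_exp_neg_mul_abs {r b : ℝ} (hr : 0 ≤ r) (hb : 0 < b) :
    Integrable fun x : ℝ => |x| ^ r * Real.exp (-b * |x|) := by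
  have hpos : IntegrableOn (fun x : ℝ => |x| ^ r * Real.exp (-b * |x|)) (Ioi 0) := by
    refine (integrableOn_rpow_mul_exp_neg_mul_rpow (p := 1) (s := r) (by linarith) one_pos hb).congr_fun
      (fun x hx => ?_) measurableSet_Ioi
    simp only [abs_of_pos (mem_Ioi.1 hx), Real.rpow_one]
  have hneg : IntegrableOn (fun x : ℝ => |x| ^ r * Real.exp (-b * |x|)) (Iic 0) := by
    rw [← Measure.map_neg_eq_self (volume : Measure ℝ)]
    have m : MeasurableEmbedding fun x : ℝ => -x := (Homeomorph.neg ℝ).measurableEmbedding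
    rw [m.integrableOn_map_iff]
    simp_rw [Function.comp_def, abs_neg, neg_preimage, neg_Iic, neg_zero]
    exact Iff.mpr integrableOn_Ici_iff_integrableOn_Ioi hpos
  rw [← integrableOn_univ, ← Iic_union_Ioi (a := (0 : ℝ))]
  exact hneg.union hpos

theorem lintegral_rpow_abs_mul_exp_pexpMeasure_lt_top {p r : ℝ} (hp : p ∈ Icc (1 : ℝ) 2)
    (hr : 0 ≤ r) :
    ∫⁻ x, ENNReal.ofReal (|x| ^ r * Real.exp (1 / 4 * |x|)) ∂pexpMeasure p < ⊤ := by
  have hp0 : 0 < p := by linarith [hp.1]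
  rw [pexpMeasure, lintegral_withDensity_eq_lintegral_mul _
    (measurable_pexpDensity p).ennreal_ofReal (by fun_prop)]
  set C := Real.exp 1 / (2 * Real.Gamma (1 / p) * p ^ (1 / p - 1))
  have hint := ((integrable_rpow_abs_mul_exp_neg_mul_abs hr
    (show (0 : ℝ) < 1 / 4 by norm_num)).const_mul C).lintegral_lt_top
  refine lt_of_le_of_lt (lintegral_mono fun x => ?_) hint
  rw [Pi.mul_apply, ← ENNReal.ofReal_mul (pexpDensity_nonneg hp0 x)]
  refine ENNReal.ofReal_le_ofReal ?_
  calc pexpDensity p x * (|x| ^ r * Real.exp (1 / 4 * |x|))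
      ≤ C * Real.exp (-(1 / 2) * |x|) * (|x| ^ r * Real.exp (1 / 4 * |x|)) := by
        gcongr
        exact pexpDensity_le_exp_neg_abs hp x
    _ = C * (|x| ^ r * (Real.exp (-(1 / 2) * |x|) * Real.exp (1 / 4 * |x|))) := by ring
    _ = C * (|x| ^ r * Real.exp (-(1 / 4) * |x|)) := by
        rw [← Real.exp_add]
        ring_nf

theorem pexpMeasure_one_le_abs_ne_zero {p : ℝ} (hp : 0 < p) :
    pexpMeasure p {x | 1 ≤ |x|} ≠ 0 := by
  rw [pexpMeasure, Ne, withDensity_apply_eq_zero (measurable_pexpDensity p).ennreal_ofReal]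
  intro h
  have hsub : Icc (1 : ℝ) 2 ⊆
      {x | ENNReal.ofReal (pexpDensity p x) ≠ 0} ∩ {x | 1 ≤ |x|} := fun x hx =>
    ⟨by simpa using pexpDensity_pos hp x, hx.1.trans (le_abs_self x)⟩
  have := measure_mono_null hsub h
  norm_num at this

theorem idx_pos (i : ℕ) : 0 < idx i := by
  unfold idx
  positivity

theorem one_le_idx (i : ℕ) : 1 ≤ idx i := by simp [idx]

theorem IsPexpPrior.map_eval {p α τ : ℝ} {μ : Measure (ℕ → ℝ)} (h : IsPexpPrior p α τ μ)
    (i : ℕ) : μ.map (fun θ => θ i) = coordLaw p α τ i := by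
  have h1 := (measurePreserving_piUnique
    (fun j : ({i} : Finset ℕ) => coordLaw p α τ j)).map_eq
  have h2 := h.2 {i}
  simp only at h2
  rw [← h2, Measure.map_map (by fun_prop) (by fun_prop)] at h1
  exact h1

theorem IsPexpPrior.map_eval_div {p α : ℝ} {μ : Measure (ℕ → ℝ)} (h : IsPexpPrior p α 1 μ)
    (i : ℕ) : μ.map (fun θ => θ i / idx i ^ (-(1 / 2 : ℝ) - α)) = pexpMeasure p := by
  have hc : idx i ^ (-(1 / 2 : ℝ) - α) ≠ 0 := (Real.rpow_pos_of_pos (idx_pos i) _).ne'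
  have hcomp : (fun θ : ℕ → ℝ => θ i / idx i ^ (-(1 / 2 : ℝ) - α)) =
      (fun x => x / idx i ^ (-(1 / 2 : ℝ) - α)) ∘ fun θ => θ i := rfl
  rw [hcomp, ← Measure.map_map (by fun_prop) (by fun_prop), h.map_eval, coordLaw,
    Measure.map_map (by fun_prop) (by fun_prop)]
  convert Measure.map_id using 2
  ext x
  simp only [Function.comp_apply, one_mul, id_eq, mul_div_cancel_left₀ _ hc]

/-- If a weighted series of nonnegative variables, each at least `1` with probability bounded away
from zero, converges almost surely, then its weights are summable. -/
theorem summable_of_ae_summable_mul {Ω : Type*} [MeasurableSpace Ω] {P : Measure Ω}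
    [IsProbabilityMeasure P] {Y : ℕ → Ω → ℝ} (hY : ∀ i, Measurable (Y i)) (hY0 : ∀ i ω, 0 ≤ Y i ω)
    {q : ENNReal} (hq : q ≠ 0) (hYq : ∀ i, q ≤ P {ω | 1 ≤ Y i ω})
    {v : ℕ → ℝ} (hv : ∀ i, 0 ≤ v i) (hs : ∀ᵐ ω ∂P, Summable fun i => v i * Y i ω) :
    Summable v := by
  set T : Ω → ENNReal := fun ω => ∑' i, ENNReal.ofReal (v i * Y i ω) with hTdef
  have hTmeas : Measurable T := by fun_prop
  have hTfin : ∀ᵐ ω ∂P, T ω ≠ ⊤ := by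
    filter_upwards [hs] with ω hω
    rw [hTdef]
    simp only
    rw [← ENNReal.ofReal_tsum_of_nonneg (fun i => mul_nonneg (hv i) (hY0 i ω)) hω]
    exact ENNReal.ofReal_ne_top
  obtain ⟨n, hn⟩ : ∃ n : ℕ, P {ω | (n : ENNReal) < T ω} < q := by
    have hlim := tendsto_measure_iInter_atTop (μ := P) (s := fun n : ℕ => {ω | (n : ENNReal) < T ω})
      (fun n => (measurableSet_lt measurable_const hTmeas).nullMeasurableSet)
      (fun m n hmn => ofPred_subset_ofPred.2 fun ω => lt_of_le_of_lt (by exact_mod_cast hmn))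
      ⟨0, measure_ne_top _ _⟩
    have hzero : P (⋂ n : ℕ, {ω | (n : ENNReal) < T ω}) = 0 := by
      refine measure_mono_null (fun ω hω => ?_) hTfin
      simp only [mem_iInter, mem_ofPred_eq] at hω
      simp only [mem_compl_iff, mem_ofPred_eq, not_not]
      by_contra hne
      obtain ⟨n, hn⟩ := ENNReal.exists_nat_gt hne
      exact absurd (hω n) hn.not_gt
    rw [hzero] at hlim
    exact (hlim.eventually_lt_const (pos_iff_ne_zero.2 hq)).exists
  set A : Set Ω := {ω | T ω ≤ n}
  have hA : MeasurableSet A := measurableSet_le hTmeas measurable_const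
  have hAc : Aᶜ = {ω | (n : ENNReal) < T ω} := by ext; simp [A]
  set δ := q - P Aᶜ with hδ
  have hδ0 : δ ≠ 0 := by
    rw [hδ, hAc]
    exact (tsub_pos_of_lt hn).ne'
  have hterm (i : ℕ) :
      ENNReal.ofReal (v i) * δ ≤ ∫⁻ ω in A, ENNReal.ofReal (v i * Y i ω) ∂P := by
    have hB : MeasurableSet {ω | 1 ≤ Y i ω} := measurableSet_le measurable_const (hY i)
    have hδle : δ ≤ P ({ω | 1 ≤ Y i ω} ∩ A) := by
      rw [hδ, tsub_le_iff_right]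
      refine (hYq i).trans ?_
      rw [← measure_inter_add_sdiff {ω | 1 ≤ Y i ω} hA]
      gcongr
      exact fun ω hω => hω.2
    calc ENNReal.ofReal (v i) * δ ≤ ENNReal.ofReal (v i) * P ({ω | 1 ≤ Y i ω} ∩ A) := by gcongr
      _ = ∫⁻ _ in {ω | 1 ≤ Y i ω} ∩ A, ENNReal.ofReal (v i) ∂P := by rw [setLIntegral_const]
      _ ≤ ∫⁻ ω in {ω | 1 ≤ Y i ω} ∩ A, ENNReal.ofReal (v i * Y i ω) ∂P :=
        setLIntegral_mono (by fun_prop) fun ω hω =>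
          ENNReal.ofReal_le_ofReal (le_mul_of_one_le_right (hv i) hω.1)
      _ ≤ _ := lintegral_mono_set inter_subset_right
  have hsum : (∑' i, ENNReal.ofReal (v i)) * δ ≤ n := by
    rw [← ENNReal.tsum_mul_right]
    calc ∑' i, ENNReal.ofReal (v i) * δ
        ≤ ∑' i, ∫⁻ ω in A, ENNReal.ofReal (v i * Y i ω) ∂P := ENNReal.tsum_le_tsum hterm
      _ = ∫⁻ ω in A, T ω ∂P := (lintegral_tsum fun i => by fun_prop).symm
      _ ≤ ∫⁻ _ in A, (n : ENNReal) ∂P := setLIntegral_mono measurable_const fun ω hω => hω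
      _ = n * P A := setLIntegral_const _ _
      _ ≤ n := mul_le_of_le_one_right' prob_le_one
  have hne : ∑' i, ENNReal.ofReal (v i) ≠ ⊤ := by
    intro h
    rw [h, ENNReal.top_mul hδ0] at hsum
    exact (ENNReal.natCast_ne_top n) (top_le_iff.1 hsum)
  simpa [ENNReal.toReal_ofReal (hv _)] using ENNReal.summable_toReal hne

/-- A pointwise substitute for Jensen's inequality: the exponential of a weighted `ℓ_r` norm is
controlled by a weighted sum of functions of the individual coordinates. -/
theorem ofReal_exp_rpow_tsum_le {r s K : ℝ} (hr : 0 < r) (hs : 0 ≤ s) (hK : 0 < K)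
    {v y : ℕ → ℝ} (hv : ∀ i, 0 ≤ v i) (hvs : Summable v) (hvK : ∑' i, v i ≤ K)
    (hy : ∀ i, 0 ≤ y i) (hvy : Summable fun i => v i * y i ^ r) :
    ENNReal.ofReal (Real.exp (s * (∑' i, v i * y i ^ r) ^ (1 / r))) ≤
      ENNReal.ofReal (Real.exp s) + 2 * ∑' i, ENNReal.ofReal (v i) *
        ENNReal.ofReal (y i ^ r * Real.exp (s * (2 * K) ^ (1 / r) * y i)) := by
  set T := ∑' i, v i * y i ^ r with hT
  have hT0 : 0 ≤ T := tsum_nonneg fun i => mul_nonneg (hv i) (Real.rpow_nonneg (hy i) _)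
  set E := Real.exp (s * T ^ (1 / r)) with hE
  have hE0 : 0 < E := Real.exp_pos _
  rcases le_total T 1 with hT1 | hT1
  · refine le_add_right (ENNReal.ofReal_le_ofReal (Real.exp_le_exp.2 ?_))
    exact mul_le_of_le_one_right hs (Real.rpow_le_one hT0 hT1 (by positivity))
  refine le_add_left ?_
  set S := ∑' i, ENNReal.ofReal (v i) *
        ENNReal.ofReal (y i ^ r * Real.exp (s * (2 * K) ^ (1 / r) * y i))
  have hterm (i : ℕ) : v i * y i ^ r * E ≤
      v i * (y i ^ r * Real.exp (s * (2 * K) ^ (1 / r) * y i)) + v i * (T * E / (2 * K)) := by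
    have hyr : 0 ≤ y i ^ r := Real.rpow_nonneg (hy i) _
    have hvi := hv i
    rw [mul_assoc, ← mul_add]
    refine mul_le_mul_of_nonneg_left ?_ (hv i)
    rcases le_total (T / (2 * K)) (y i ^ r) with h | h
    · have hroot : T ^ (1 / r) ≤ (2 * K) ^ (1 / r) * y i := by
        calc T ^ (1 / r) ≤ (2 * K * y i ^ r) ^ (1 / r) := by
              gcongr
              rwa [div_le_iff₀' (by positivity)] at h
          _ = (2 * K) ^ (1 / r) * y i := by
              rw [Real.mul_rpow (by positivity) hyr, ← Real.rpow_mul (hy i),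
                mul_one_div_cancel hr.ne', Real.rpow_one]
      have hexp : E ≤ Real.exp (s * (2 * K) ^ (1 / r) * y i) := by
        rw [hE, mul_assoc]
        gcongr
      exact le_add_of_le_of_nonneg (by gcongr) (by positivity)
    · refine le_add_of_nonneg_of_le (by positivity) ?_
      rw [mul_div_right_comm]
      gcongr
  have hmain : ENNReal.ofReal (T * E / 2) + ENNReal.ofReal (T * E / 2) ≤
      S + ENNReal.ofReal (T * E / 2) := by
    rw [← ENNReal.ofReal_add (by positivity) (by positivity), add_halves]
    calc ENNReal.ofReal (T * E) = ∑' i, ENNReal.ofReal (v i * y i ^ r * E) := by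
          rw [hT, ← tsum_mul_right]
          exact ENNReal.ofReal_tsum_of_nonneg (fun i => mul_nonneg
            (mul_nonneg (hv i) (Real.rpow_nonneg (hy i) _)) hE0.le) (hvy.mul_right E)
      _ ≤ ∑' i, (ENNReal.ofReal (v i) *
            ENNReal.ofReal (y i ^ r * Real.exp (s * (2 * K) ^ (1 / r) * y i)) +
            ENNReal.ofReal (v i * (T * E / (2 * K)))) := by
          refine ENNReal.tsum_le_tsum fun i => ?_
          rw [← ENNReal.ofReal_mul (hv i)]
          exact (ENNReal.ofReal_le_ofReal (hterm i)).trans ENNReal.ofReal_add_le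
      _ = S + ENNReal.ofReal ((∑' i, v i) * (T * E / (2 * K))) := by
          rw [ENNReal.tsum_add, ← hvs.tsum_mul_right, ENNReal.ofReal_tsum_of_nonneg
            (fun i => mul_nonneg (hv i) (by positivity)) (hvs.mul_right _)]
      _ ≤ S + ENNReal.ofReal (T * E / 2) := by
          gcongr
          calc (∑' i, v i) * (T * E / (2 * K)) ≤ K * (T * E / (2 * K)) := by gcongr
            _ = T * E / 2 := by field_simp
  have hhalf : ENNReal.ofReal (T * E / 2) ≤ S :=
    ENNReal.le_of_add_le_add_right ENNReal.ofReal_ne_top hmain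
  calc ENNReal.ofReal E ≤ ENNReal.ofReal (2 * (T * E / 2)) :=
        ENNReal.ofReal_le_ofReal (by nlinarith)
    _ = 2 * ENNReal.ofReal (T * E / 2) := by
        rw [ENNReal.ofReal_mul zero_le_two, ENNReal.ofReal_ofNat]
    _ ≤ 2 * S := by gcongr

/-- **Lemma A.1** (uniform Fernique-type theorem): for a weighted `ℓ_r` norm `μ` which is
finite almost surely under every `α`-regular `p`-exponential measure `Π_α`, `α ≥ α₁`, the
exponential moments `∫ e^{s₂ μ(θ)} dΠ_α` are bounded uniformly in `α ≥ α₁`. -/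
theorem fernique_uniform
    (p : ℝ) (hp : p ∈ Set.Icc (1 : ℝ) 2)
    (α₁ : ℝ) (hα₁ : 0 < α₁)
    -- the α-regular p-exponential measures Π_α = Π(·|α, τ = 1)
    (Pi : ℝ → Measure (ℕ → ℝ))
    (hPi : ∀ α : ℝ, 0 < α → IsPexpPrior p α 1 (Pi α))
    -- μ : a weighted ℓ_r norm with weights w, r ≥ 1
    (r : ℝ) (hr : 1 ≤ r)
    (w : ℕ → ℝ) (hw : ∀ i, 0 ≤ w i)
    -- μ is finite Π_α-almost surely, for every α ≥ α₁
    (hfin : ∀ α : ℝ, α₁ ≤ α →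
      ∀ᵐ θ ∂(Pi α), Summable fun i => w i * |θ i| ^ r) :
    ∃ s₁ : ℝ, 0 < s₁ ∧ ∃ s₂ : ℝ, 0 < s₂ ∧
      ∀ α : ℝ, α₁ ≤ α →
        ∫⁻ θ, ENNReal.ofReal
            (Real.exp (s₂ * (∑' i, w i * |θ i| ^ r) ^ (1 / r))) ∂(Pi α) ≤
          ENNReal.ofReal s₁ := by
  have hp0 : 0 < p := by linarith [hp.1]
  have hr0 : 0 < r := by linarith
  set c : ℝ → ℕ → ℝ := fun α i => idx i ^ (-(1 / 2 : ℝ) - α)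
  have hc (α : ℝ) (i : ℕ) : 0 < c α i := Real.rpow_pos_of_pos (idx_pos i) _
  set v : ℝ → ℕ → ℝ := fun α i => w i * c α i ^ r
  have hv (α : ℝ) (i : ℕ) : 0 ≤ v α i := mul_nonneg (hw i) (Real.rpow_nonneg (hc α i).le _)
  have hscale (α : ℝ) (θ : ℕ → ℝ) (i : ℕ) :
      w i * |θ i| ^ r = v α i * |θ i / c α i| ^ r := by
    have := hc α i
    rw [mul_assoc, ← Real.mul_rpow (hc α i).le (abs_nonneg _), abs_div, abs_of_pos this,
      mul_div_cancel₀ _ this.ne']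
  have hvle (α : ℝ) (hα : α₁ ≤ α) (i : ℕ) : v α i ≤ v α₁ i := by
    have h : c α i ≤ c α₁ i :=
      Real.rpow_le_rpow_of_exponent_le (one_le_idx i) (by linarith)
    exact mul_le_mul_of_nonneg_left (Real.rpow_le_rpow (hc α i).le h hr0.le) (hw i)
  have hvs₁ : Summable (v α₁) := by
    have := (hPi α₁ hα₁).1
    refine summable_of_ae_summable_mul (P := Pi α₁) (Y := fun i θ => |θ i / c α₁ i| ^ r)
      (fun i => by fun_prop) (fun i θ => by positivity)
      (pexpMeasure_one_le_abs_ne_zero hp0) (fun i => ?_) (hv α₁) ?_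
    · rw [← (hPi α₁ hα₁).map_eval_div i,
        Measure.map_apply (by fun_prop) (measurableSet_le measurable_const (by fun_prop))]
      exact measure_mono fun θ hθ => Real.one_le_rpow hθ hr0.le
    · filter_upwards [hfin α₁ le_rfl] with θ hθ
      simpa only [hscale α₁] using hθ
  obtain ⟨K, hK, hvK₁⟩ : ∃ K : ℝ, 0 < K ∧ ∑' i, v α₁ i ≤ K :=
    ⟨∑' i, v α₁ i + 1, add_pos_of_nonneg_of_pos (tsum_nonneg (hv α₁)) one_pos, by linarith⟩
  have hKr : 0 < (2 * K) ^ (1 / r) := by positivity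
  set s := 1 / 4 / (2 * K) ^ (1 / r)
  have hs : 0 < s := by positivity
  have hsK : s * (2 * K) ^ (1 / r) = 1 / 4 := div_mul_cancel₀ _ hKr.ne'
  set M := ∫⁻ x, ENNReal.ofReal (|x| ^ r * Real.exp (1 / 4 * |x|)) ∂pexpMeasure p
  have hM : M ≠ ⊤ := (lintegral_rpow_abs_mul_exp_pexpMeasure_lt_top hp hr0.le).ne
  refine ⟨Real.exp s + 2 * (K * M.toReal), by positivity, s, hs, fun α hα => ?_⟩
  have hα0 : 0 < α := hα₁.trans_le hα
  have := (hPi α hα0).1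
  have hvs : Summable (v α) := hvs₁.of_nonneg_of_le (hv α) (hvle α hα)
  have hvK : ∑' i, v α i ≤ K :=
    (hvs.tsum_le_tsum (hvle α hα) hvs₁).trans hvK₁
  have hmoment (i : ℕ) : ∫⁻ θ, ENNReal.ofReal
      (|θ i / c α i| ^ r * Real.exp (1 / 4 * |θ i / c α i|)) ∂Pi α = M := by
    simp only [M]
    rw [← (hPi α hα0).map_eval_div i, lintegral_map (by fun_prop) (by fun_prop)]
  calc ∫⁻ θ, ENNReal.ofReal (Real.exp (s * (∑' i, w i * |θ i| ^ r) ^ (1 / r))) ∂Pi α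
      ≤ ∫⁻ θ, (ENNReal.ofReal (Real.exp s) + 2 * ∑' i, ENNReal.ofReal (v α i) *
          ENNReal.ofReal (|θ i / c α i| ^ r * Real.exp (1 / 4 * |θ i / c α i|))) ∂Pi α := by
        refine lintegral_mono_ae ?_
        filter_upwards [hfin α hα] with θ hθ
        simp only [hscale α] at hθ ⊢
        simpa only [hsK] using ofReal_exp_rpow_tsum_le hr0 hs.le hK (hv α) hvs hvK
          (fun i => abs_nonneg (θ i / c α i)) hθ
    _ = ENNReal.ofReal (Real.exp s) + 2 * ∑' i, ENNReal.ofReal (v α i) * M := by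
        rw [lintegral_add_left measurable_const, lintegral_const, measure_univ, mul_one,
          lintegral_const_mul _ (by fun_prop), lintegral_tsum fun i => by fun_prop]
        congr 3 with i
        rw [lintegral_const_mul _ (by fun_prop), hmoment i]
    _ = ENNReal.ofReal (Real.exp s) + 2 * (ENNReal.ofReal (∑' i, v α i) * M) := by
        rw [ENNReal.tsum_mul_right, ENNReal.ofReal_tsum_of_nonneg (hv α) hvs]
    _ ≤ ENNReal.ofReal (Real.exp s) + 2 * (ENNReal.ofReal K * M) := by gcongr
    _ = ENNReal.ofReal (Real.exp s + 2 * (K * M.toReal)) := by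
        rw [ENNReal.ofReal_add (by positivity) (by positivity), ENNReal.ofReal_mul zero_le_two,
          ENNReal.ofReal_mul hK.le, ENNReal.ofReal_toReal hM, ENNReal.ofReal_ofNat]
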